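/- Let 0 < λ ≤ π/2 and let g ∈ C_{λe}. Then the pre-Schwarzian norm of g satisfies ||P_g|| ≤ (1 − α²)(e^{λα} − 1)/α, where α is the unique root in (0,1) of the equation λr e^{λr}(1 − r²) − (1 + r²)(e^{λr} − 1) = 0. -/

import Mathlib

open Metric Set

noncomputable section

/-- The open unit disk in the complex plane. -/
def unitDisk : Set ℂ := Metric.ball 0 1

/-- A function is normalized if it is analytic on the unit disk with f(0)=0 and f'(0)=1. -/
def IsNormalized (f : ℂ → ℂ) : Prop :=
  AnalyticOnNhd ℂ f unitDisk ∧ f 0 = 0 ∧ deriv f 0 = 1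

/-- Subordination: f ≺ g on the unit disk. -/
def Subord (f g : ℂ → ℂ) : Prop :=
  ∃ ω : ℂ → ℂ, AnalyticOnNhd ℂ ω unitDisk ∧ ω 0 = 0 ∧
    Set.MapsTo ω unitDisk unitDisk ∧ Set.EqOn f (g ∘ ω) unitDisk

/-- The quantity z f'(z)/f(z), extended by its analytic value 1 at z = 0. -/
def sratio (f : ℂ → ℂ) (z : ℂ) : ℂ := if z = 0 then 1 else z * deriv f z / f z

/-- The Ma-Minda starlike class S*(φ). -/
def MemSstar (φ f : ℂ → ℂ) : Prop :=
  IsNormalized f ∧ (∀ z ∈ unitDisk, z ≠ 0 → f z ≠ 0) ∧ Subord (sratio f) φ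

/-- The Ma-Minda convex class C(φ). -/
def MemC (φ g : ℂ → ℂ) : Prop :=
  IsNormalized g ∧ (∀ z ∈ unitDisk, deriv g z ≠ 0) ∧
    Subord (fun z => 1 + z * deriv (deriv g) z / deriv g z) φ

/-- The set of values (1-|z|²)|P_f(z)|, z ∈ 𝔻, whose supremum is the pre-Schwarzian norm. -/
def pSVals (f : ℂ → ℂ) : Set ℝ :=
  {x : ℝ | ∃ z ∈ unitDisk, x = (1 - ‖z‖^2) * ‖deriv (deriv f) z / deriv f z‖}

/-- The extremal profile `(1 - r²)(e^{λr} - 1)/r`. -/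
def radialProfile (lam r : ℝ) : ℝ := (1 - r^2) * (Real.exp (lam*r) - 1) / r

/-- The function `r² · (radialProfile lam)'(r)`. -/
def criticalFn (lam r : ℝ) : ℝ :=
  lam*r*Real.exp (lam*r)*(1 - r^2) - (1 + r^2)*(Real.exp (lam*r) - 1)

/-- The function `(criticalFn lam)'(r) / r`. -/
def criticalSlope (lam r : ℝ) : ℝ :=
  lam^2*Real.exp (lam*r)*(1 - r^2) - 4*lam*r*Real.exp (lam*r) - 2*(Real.exp (lam*r) - 1)

lemma hasDerivAt_exp_const_mul (lam r : ℝ) :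
    HasDerivAt (fun r => Real.exp (lam*r)) (lam * Real.exp (lam*r)) r := by
  simpa [mul_comm] using ((hasDerivAt_id r).const_mul lam).exp

lemma hasDerivAt_radialProfile (lam : ℝ) {r : ℝ} (hr : r ≠ 0) :
    HasDerivAt (radialProfile lam) (criticalFn lam r / r^2) r := by
  have hE := hasDerivAt_exp_const_mul lam r
  have hid := hasDerivAt_id' r
  refine ((((hid.pow 2).const_sub 1).mul (hE.sub_const 1)).div hid hr).congr_deriv ?_
  simp [criticalFn]
  field_simp
  ring

lemma hasDerivAt_criticalFn (lam r : ℝ) :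
    HasDerivAt (criticalFn lam) (r * criticalSlope lam r) r := by
  have hE := hasDerivAt_exp_const_mul lam r
  have hid := hasDerivAt_id' r
  refine ((((hid.const_mul lam).mul hE).mul ((hid.pow 2).const_sub 1)).sub
    (((hid.pow 2).const_add 1).mul (hE.sub_const 1))).congr_deriv ?_
  simp [criticalSlope]
  ring

lemma hasDerivAt_criticalSlope (lam r : ℝ) :
    HasDerivAt (criticalSlope lam)
      (lam * Real.exp (lam*r) * (lam^2*(1 - r^2) - 6*lam*r - 6)) r := by
  have hE := hasDerivAt_exp_const_mul lam r
  have hid := hasDerivAt_id' r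
  refine ((((hE.const_mul (lam^2)).mul ((hid.pow 2).const_sub 1)).sub
    ((hid.const_mul (4*lam)).mul hE)).sub ((hE.sub_const 1).const_mul 2)).congr_deriv ?_
  simp
  ring

lemma monotoneOn_of_hasDerivAt_nonneg {D : Set ℝ} (hD : Convex ℝ D) {f f' : ℝ → ℝ}
    (hf : ∀ x ∈ D, HasDerivAt f (f' x) x) (hf' : ∀ x ∈ D, 0 ≤ f' x) : MonotoneOn f D :=
  monotoneOn_of_hasDerivWithinAt_nonneg hD (fun x hx => (hf x hx).continuousAt.continuousWithinAt)
    (fun x hx => (hf x (interior_subset hx)).hasDerivWithinAt)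
    (fun x hx => hf' x (interior_subset hx))

lemma antitoneOn_of_hasDerivAt_nonpos {D : Set ℝ} (hD : Convex ℝ D) {f f' : ℝ → ℝ}
    (hf : ∀ x ∈ D, HasDerivAt f (f' x) x) (hf' : ∀ x ∈ D, f' x ≤ 0) : AntitoneOn f D :=
  antitoneOn_of_hasDerivWithinAt_nonpos hD (fun x hx => (hf x hx).continuousAt.continuousWithinAt)
    (fun x hx => (hf x (interior_subset hx)).hasDerivWithinAt)
    (fun x hx => hf' x (interior_subset hx))

lemma strictAntiOn_criticalSlope {lam : ℝ} (h0 : 0 < lam) (h6 : lam^2 < 6) :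
    StrictAntiOn (criticalSlope lam) (Ici 0) := by
  refine strictAntiOn_of_deriv_neg (convex_Ici 0)
    (fun x _ => (hasDerivAt_criticalSlope lam x).continuousAt.continuousWithinAt) fun x hx => ?_
  rw [(hasDerivAt_criticalSlope lam x).deriv]
  have hx0 : 0 ≤ x := interior_subset hx
  refine mul_neg_of_pos_of_neg (by positivity) ?_
  nlinarith [mul_nonneg h0.le hx0, sq_nonneg (lam * x)]

lemma criticalFn_zero (lam : ℝ) : criticalFn lam 0 = 0 := by simp [criticalFn]

/-- At a positive zero of `criticalFn`, `criticalSlope` is nonpositive. -/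
lemma criticalSlope_nonpos_of_root {lam α : ℝ} (h0 : 0 < lam) (h6 : lam^2 < 6) (hα : 0 < α)
    (hroot : criticalFn lam α = 0) : criticalSlope lam α ≤ 0 := by
  obtain ⟨c, hc, hc'⟩ := exists_hasDerivAt_eq_zero hα
    (fun x _ => (hasDerivAt_criticalFn lam x).continuousAt.continuousWithinAt)
    ((criticalFn_zero lam).trans hroot.symm) (fun x _ => hasDerivAt_criticalFn lam x)
  have := (mul_eq_zero.mp hc').resolve_left hc.1.ne'
  rw [← this]
  exact (strictAntiOn_criticalSlope h0 h6 hc.1.le hα.le hc.2).le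

lemma criticalFn_nonpos_of_root_le {lam α r : ℝ} (h0 : 0 < lam) (h6 : lam^2 < 6) (hα : 0 < α)
    (hroot : criticalFn lam α = 0) (hr : α ≤ r) : criticalFn lam r ≤ 0 := by
  have hanti := (strictAntiOn_criticalSlope h0 h6).antitoneOn
  have hs := criticalSlope_nonpos_of_root h0 h6 hα hroot
  rw [← hroot]
  refine antitoneOn_of_hasDerivAt_nonpos (convex_Ici α) (fun x _ => hasDerivAt_criticalFn lam x)
    (fun x hx => ?_) (mem_Ici.2 le_rfl) hr hr
  have hx0 : 0 ≤ x := hα.le.trans hx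
  exact mul_nonpos_of_nonneg_of_nonpos hx0 ((hanti hα.le hx0 hx).trans hs)

lemma criticalFn_nonneg_of_le_root {lam α r : ℝ} (h0 : 0 < lam) (h6 : lam^2 < 6)
    (hroot : criticalFn lam α = 0) (hr0 : 0 ≤ r) (hr : r ≤ α) : 0 ≤ criticalFn lam r := by
  have hanti := (strictAntiOn_criticalSlope h0 h6).antitoneOn
  rcases le_total 0 (criticalSlope lam r) with hs | hs
  · rw [← criticalFn_zero lam]
    exact monotoneOn_of_hasDerivAt_nonneg (convex_Icc 0 r)
      (fun x _ => hasDerivAt_criticalFn lam x)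
      (fun x hx => mul_nonneg hx.1 (hs.trans (hanti hx.1 hr0 hx.2)))
      (left_mem_Icc.2 hr0) (right_mem_Icc.2 hr0) hr0
  · rw [← hroot]
    exact antitoneOn_of_hasDerivAt_nonpos (convex_Icc r α)
      (fun x _ => hasDerivAt_criticalFn lam x)
      (fun x hx => mul_nonpos_of_nonneg_of_nonpos (hr0.trans hx.1)
        ((hanti hr0 (hr0.trans hx.1) hx.1).trans hs))
      (left_mem_Icc.2 hr) (right_mem_Icc.2 hr) hr

/-- A positive zero of `criticalFn` maximizes `radialProfile` on the positive axis. -/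
lemma radialProfile_le_of_root {lam α r : ℝ} (h0 : 0 < lam) (h6 : lam^2 < 6) (hα : 0 < α)
    (hroot : criticalFn lam α = 0) (hr : 0 < r) :
    radialProfile lam r ≤ radialProfile lam α := by
  rcases le_total r α with h | h
  · exact monotoneOn_of_hasDerivAt_nonneg (convex_Icc r α)
      (fun x hx => hasDerivAt_radialProfile lam (hr.trans_le hx.1).ne')
      (fun x hx => div_nonneg
        (criticalFn_nonneg_of_le_root h0 h6 hroot (hr.le.trans hx.1) hx.2) (sq_nonneg x))
      (left_mem_Icc.2 h) (right_mem_Icc.2 h) h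
  · exact antitoneOn_of_hasDerivAt_nonpos (convex_Icc α r)
      (fun x hx => hasDerivAt_radialProfile lam (hα.trans_le hx.1).ne')
      (fun x hx => div_nonpos_of_nonpos_of_nonneg
        (criticalFn_nonpos_of_root_le h0 h6 hα hroot hx.1) (sq_nonneg x))
      (left_mem_Icc.2 h) (right_mem_Icc.2 h) h

lemma norm_exp_sub_one_le_exp_norm_sub_one (w : ℂ) :
    ‖Complex.exp w - 1‖ ≤ Real.exp ‖w‖ - 1 := by
  simpa using Complex.norm_exp_sub_sum_le_exp_norm_sub_sum w 1

/-- By the Schwarz lemma, `|z P_g(z)| ≤ e^{λ|z|} - 1` for `g` in the class `C_{λe}`. -/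
lemma MemC.norm_mul_preSchwarzian_le {lam : ℝ} (h0 : 0 ≤ lam) {g : ℂ → ℂ}
    (hg : MemC (fun z => Complex.exp ((lam:ℂ) * z)) g) {z : ℂ} (hz : z ∈ unitDisk) :
    ‖z‖ * ‖deriv (deriv g) z / deriv g z‖ ≤ Real.exp (lam * ‖z‖) - 1 := by
  obtain ⟨-, -, ω, hω, hω0, hmaps, heq⟩ := hg
  have hωz : ‖ω z‖ ≤ ‖z‖ :=
    Complex.norm_le_norm_of_mapsTo_ball (R := 1) hω.differentiableOn
      (hmaps.mono_right ball_subset_closedBall) hω0 (mem_ball_zero_iff.mp hz)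
  have h : z * (deriv (deriv g) z / deriv g z) = Complex.exp (lam * ω z) - 1 := by
    have := heq hz
    simp only [Function.comp_apply] at this
    rw [← this]
    ring
  rw [← norm_mul, h]
  refine (norm_exp_sub_one_le_exp_norm_sub_one _).trans ?_
  rw [norm_mul, Complex.norm_real, Real.norm_of_nonneg h0]
  gcongr

lemma MemC.continuousAt_preSchwarzian {φ g : ℂ → ℂ} (hg : MemC φ g) {z : ℂ}
    (hz : z ∈ unitDisk) : ContinuousAt (fun z => deriv (deriv g) z / deriv g z) z :=
  ((hg.1.1 z hz).deriv.deriv.continuousAt).div (hg.1.1 z hz).deriv.continuousAt (hg.2.1 z hz)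

/-- Pre-Schwarzian norm estimate for the class C_{λe}. -/
theorem preSchwarzian_bound_C_lambda_e (lam : ℝ) (hlam₀ : 0 < lam)
    (hlam₁ : lam ≤ Real.pi / 2) (g : ℂ → ℂ)
    (hg : MemC (fun z => Complex.exp ((lam:ℂ) * z)) g)
    (α : ℝ) (hα : α ∈ Set.Ioo (0:ℝ) 1)
    (hroot : lam*α*Real.exp (lam*α)*(1 - α^2) - (1 + α^2)*(Real.exp (lam*α) - 1) = 0) :
    ∀ z ∈ unitDisk, (1 - ‖z‖^2) * ‖deriv (deriv g) z / deriv g z‖ ≤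
      (1 - α^2) * (Real.exp (lam*α) - 1) / α := by
  have h6 : lam^2 < 6 := by nlinarith [Real.pi_lt_d2, Real.pi_pos]
  have hne : ∀ z ∈ unitDisk, z ≠ 0 → (1 - ‖z‖^2) * ‖deriv (deriv g) z / deriv g z‖ ≤
      (1 - α^2) * (Real.exp (lam*α) - 1) / α := by
    intro z hz hz0
    have hzpos : 0 < ‖z‖ := norm_pos_iff.2 hz0
    have hz1 : ‖z‖ < 1 := mem_ball_zero_iff.mp hz
    refine le_trans ?_ (radialProfile_le_of_root hlam₀ h6 hα.1 hroot hzpos)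
    rw [radialProfile, mul_div_assoc]
    refine mul_le_mul_of_nonneg_left ?_ (by nlinarith)
    rw [le_div_iff₀ hzpos, mul_comm]
    exact hg.norm_mul_preSchwarzian_le hlam₀.le hz
  intro z hz
  rcases ne_or_eq z 0 with hz0 | rfl
  · exact hne z hz hz0
  have hcont : ContinuousAt
      (fun z : ℂ => (1 - ‖z‖^2) * ‖deriv (deriv g) z / deriv g z‖) 0 :=
    ContinuousAt.mul (by fun_prop) (hg.continuousAt_preSchwarzian hz).norm
  refine le_of_tendsto (hcont.tendsto.mono_left (nhdsWithin_le_nhds (s := {0}ᶜ))) ?_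
  filter_upwards [self_mem_nhdsWithin, nhdsWithin_le_nhds (isOpen_ball.mem_nhds hz)] with w hw0 hw
  exact hne w hw hw0
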